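/- arXiv:1410.1300 — 2 statements merged into one kernel-verified Lean document; each statement's English description precedes it below -/
import Mathlib

section
/- Let β > 0, let k = 4/(4+β), and let f₊₋(x,y,z) = β(x²y²+y²z²+z²x²) + (x²+y²+z²−1/2)² − (1−k)/4. Then the set of singular points of the quartic Q⁺⁻(k) = {f₊₋ = 0}, that is, the set of points at which f₊₋ and all three of its partial derivatives vanish, is exactly the set of twelve points obtained from (t,t,0), with t = 1/√(β+4), by permuting the coordinates and changing signs of coordinates: (±t,±t,0), (±t,0,±t), (0,±t,±t) (the centers of the edges of an octahedron). -/
/-- The quartic polynomial `β·v + (u - 1/2)² - (1-k)/4` defining `Q⁺⁻(k)`. -/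
noncomputable def fPM (β k : ℝ) (p : EuclideanSpace ℝ (Fin 3)) : ℝ :=
  β * ((p 0)^2*(p 1)^2 + (p 1)^2*(p 2)^2 + (p 2)^2*(p 0)^2)
    + ((p 0)^2 + (p 1)^2 + (p 2)^2 - 1/2)^2 - (1 - k)/4

/-- The differential of `fPM β k` at `p`, in terms of its partial derivatives. -/
theorem hasFDerivAt_fPM (β k : ℝ) (p : EuclideanSpace ℝ (Fin 3)) :
    HasFDerivAt (fPM β k)
      ((2 * (p 0 * (β * ((p 1)^2 + (p 2)^2) + 2 * ((p 0)^2 + (p 1)^2 + (p 2)^2 - 1/2)))) •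
          (EuclideanSpace.proj 0 : EuclideanSpace ℝ (Fin 3) →L[ℝ] ℝ) +
        (2 * (p 1 * (β * ((p 0)^2 + (p 2)^2) + 2 * ((p 0)^2 + (p 1)^2 + (p 2)^2 - 1/2)))) •
          (EuclideanSpace.proj 1 : EuclideanSpace ℝ (Fin 3) →L[ℝ] ℝ) +
        (2 * (p 2 * (β * ((p 0)^2 + (p 1)^2) + 2 * ((p 0)^2 + (p 1)^2 + (p 2)^2 - 1/2)))) •
          (EuclideanSpace.proj 2 : EuclideanSpace ℝ (Fin 3) →L[ℝ] ℝ)) p := by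
  have hsq (i : Fin 3) : HasFDerivAt (fun q : EuclideanSpace ℝ (Fin 3) => (q i)^2) _ p :=
    ((EuclideanSpace.proj i : EuclideanSpace ℝ (Fin 3) →L[ℝ] ℝ).hasFDerivAt (x := p)).pow 2
  have h := ((((((hsq 0).mul (hsq 1)).add ((hsq 1).mul (hsq 2))).add
    ((hsq 2).mul (hsq 0))).const_mul β).add
    (((((hsq 0).add (hsq 1)).add (hsq 2)).sub_const (1/2)).pow 2)).sub_const ((1 - k)/4)
  refine h.congr_fderiv ?_
  ext v
  simp
  ring

/-- `fPM β k` is critical at `p` exactly when its three partial derivatives vanish. -/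
theorem fderiv_fPM_eq_zero_iff (β k : ℝ) (p : EuclideanSpace ℝ (Fin 3)) :
    fderiv ℝ (fPM β k) p = 0 ↔
      p 0 * (β * ((p 1)^2 + (p 2)^2) + 2 * ((p 0)^2 + (p 1)^2 + (p 2)^2 - 1/2)) = 0 ∧
      p 1 * (β * ((p 0)^2 + (p 2)^2) + 2 * ((p 0)^2 + (p 1)^2 + (p 2)^2 - 1/2)) = 0 ∧
      p 2 * (β * ((p 0)^2 + (p 1)^2) + 2 * ((p 0)^2 + (p 1)^2 + (p 2)^2 - 1/2)) = 0 := by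
  rw [(hasFDerivAt_fPM β k p).fderiv]
  constructor
  · intro h
    have hv (i : Fin 3) := DFunLike.congr_fun h (EuclideanSpace.single i (1 : ℝ))
    exact ⟨by simpa using hv 0, by simpa using hv 1, by simpa using hv 2⟩
  · rintro ⟨h0, h1, h2⟩
    rw [h0, h1, h2]
    simp

/-- Both square roots of `1 / c`, when `c > 0`. -/
theorem eq_or_eq_neg_one_div_sqrt {c x : ℝ} (hc : 0 < c) :
    (x = 1/Real.sqrt c ∨ x = -(1/Real.sqrt c)) ↔ c * x^2 = 1 := by
  rw [← sq_eq_sq_iff_eq_or_eq_neg, div_pow, Real.sq_sqrt hc.le, one_pow, eq_div_iff hc.ne',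
    mul_comm]

/-- The value and critical point equations of `fPM β (4/(4+β))` force exactly one coordinate to
vanish, the other two having square `1/(β+4)`. -/
theorem singular_equations_iff {β : ℝ} (hβ : 0 < β) (x y z : ℝ) :
    (β * (x^2*y^2 + y^2*z^2 + z^2*x^2) + (x^2 + y^2 + z^2 - 1/2)^2 - (1 - 4/(4+β))/4 = 0 ∧
      x * (β * (y^2 + z^2) + 2 * (x^2 + y^2 + z^2 - 1/2)) = 0 ∧
      y * (β * (x^2 + z^2) + 2 * (x^2 + y^2 + z^2 - 1/2)) = 0 ∧
      z * (β * (x^2 + y^2) + 2 * (x^2 + y^2 + z^2 - 1/2)) = 0) ↔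
    ((β+4) * x^2 = 1 ∧ (β+4) * y^2 = 1 ∧ z = 0) ∨
    ((β+4) * x^2 = 1 ∧ y = 0 ∧ (β+4) * z^2 = 1) ∨
    (x = 0 ∧ (β+4) * y^2 = 1 ∧ (β+4) * z^2 = 1) := by
  have hc : (β + 4) ≠ 0 := by positivity
  have hk : (1 - 4/(4+β))/4 = β/(4*(β+4)) := by
    rw [add_comm 4 β]; field_simp; ring
  rw [hk]
  constructor
  · rintro ⟨hf, h0, h1, h2⟩
    have hf' : 4*(β+4)*(β * (x^2*y^2 + y^2*z^2 + z^2*x^2) + (x^2 + y^2 + z^2 - 1/2)^2) = β := by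
      rw [sub_eq_zero.mp hf]; field_simp
    clear hf
    have key {a b : ℝ} (h : β * (a - b) = 0) : a = b :=
      sub_eq_zero.mp ((mul_eq_zero.mp h).resolve_left hβ.ne')
    rcases mul_eq_zero.mp h0 with hx | hx <;> rcases mul_eq_zero.mp h1 with hy | hy <;>
      rcases mul_eq_zero.mp h2 with hz | hz
    · subst hx hy hz; exfalso; nlinarith
    · subst hx hy; exfalso
      have : z^2 = 1/2 := by linarith
      simp [this] at hf'
      linarith
    · subst hx hz; exfalso
      have : y^2 = 1/2 := by linarith
      simp [this] at hf'
      linarith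
    · subst hx
      have : y^2 = z^2 := key (by linarith)
      right; right
      exact ⟨rfl, by linear_combination hy + (β + 2) * this, by linear_combination hy - 2 * this⟩
    · subst hy hz; exfalso
      have : x^2 = 1/2 := by linarith
      simp [this] at hf'
      linarith
    · subst hy
      have : x^2 = z^2 := key (by linarith)
      right; left
      exact ⟨by linear_combination hx + (β + 2) * this, rfl, by linear_combination hx - 2 * this⟩
    · subst hz
      have : x^2 = y^2 := key (by linarith)
      left
      exact ⟨by linear_combination hx + (β + 2) * this, by linear_combination hx - 2 * this, rfl⟩
    · exfalso
      have hxz : x^2 = z^2 := key (by linarith)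
      have hyz : y^2 = z^2 := key (by linarith)
      rw [hxz, hyz] at hf' hx
      have hZ : z^2 = 1/(2*(β+3)) := by
        rw [eq_div_iff (by positivity)]; linarith
      rw [hZ] at hf'
      field_simp at hf'
      nlinarith
  · have hsq {a : ℝ} (h : (β+4) * a^2 = 1) : a^2 = 1/(β+4) := by
      rw [eq_div_iff hc]; linarith
    rintro (⟨h, h', rfl⟩ | ⟨h, rfl, h'⟩ | ⟨rfl, h, h'⟩) <;> rw [hsq h, hsq h'] <;>
      refine ⟨?_, ?_, ?_, ?_⟩ <;> field_simp <;> ring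

/-- for `β > 0` and `k = 4/(4+β)`, the singular points of `Q⁺⁻(k)`
are the twelve points `(±t,±t,0), (±t,0,±t), (0,±t,±t)` with `t = 1/√(β+4)`
(centers of the edges of an octahedron). -/
theorem stmt_12 (β : ℝ) (hβ : 0 < β) (k : ℝ) (hk : k = 4/(4+β)) :
    {p : EuclideanSpace ℝ (Fin 3) |
        fPM β k p = 0 ∧ fderiv ℝ (fPM β k) p = 0} =
      {p : EuclideanSpace ℝ (Fin 3) | ∃ a b : ℝ,
        (a = 1/Real.sqrt (β+4) ∨ a = -(1/Real.sqrt (β+4))) ∧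
        (b = 1/Real.sqrt (β+4) ∨ b = -(1/Real.sqrt (β+4))) ∧
        ((p 0 = a ∧ p 1 = b ∧ p 2 = 0) ∨
         (p 0 = a ∧ p 1 = 0 ∧ p 2 = b) ∨
         (p 0 = 0 ∧ p 1 = a ∧ p 2 = b))} := by
  subst hk
  have hc : 0 < β + 4 := by positivity
  ext p
  simp only [Set.mem_ofPred_eq, fderiv_fPM_eq_zero_iff, eq_or_eq_neg_one_div_sqrt hc]
  rw [fPM, singular_equations_iff hβ]
  constructor
  · rintro (⟨h, h', h0⟩ | ⟨h, h0, h'⟩ | ⟨h0, h, h'⟩)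
    · exact ⟨_, _, h, h', Or.inl ⟨rfl, rfl, h0⟩⟩
    · exact ⟨_, _, h, h', Or.inr (Or.inl ⟨rfl, h0, rfl⟩)⟩
    · exact ⟨_, _, h, h', Or.inr (Or.inr ⟨h0, rfl, rfl⟩)⟩
  · rintro ⟨a, b, ha, hb, ⟨rfl, rfl, h0⟩ | ⟨rfl, h0, rfl⟩ | ⟨h0, rfl, rfl⟩⟩
    · exact Or.inl ⟨ha, hb, h0⟩
    · exact Or.inr (Or.inl ⟨ha, h0, hb⟩)
    · exact Or.inr (Or.inr ⟨h0, ha, hb⟩)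
end

section
/- Let β satisfy 0 < β < 3 and let k satisfy 0 < k < 1. Then Q⁻⁺(k) = {(x,y,z) ∈ ℝ³ : β(x²y²+y²z²+z²x²) − (x²+y²+z²−1/2)² + (1−k)/4 = 0} has exactly two connected components, and each of these components is compact and homeomorphic to the 2-sphere. -/
open Set Metric Topology

/-- If a set is the disjoint union of two closed preconnected sets, then each of them is the
connected component of any of its points. -/
theorem connectedComponentIn_union_left {X : Type*} [TopologicalSpace X] {A B : Set X}
    (hA : IsClosed A) (hB : IsClosed B) (hAB : Disjoint A B) (hAc : IsPreconnected A)
    {p : X} (hp : p ∈ A) : connectedComponentIn (A ∪ B) p = A := by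
  refine Subset.antisymm ?_ (hAc.subset_connectedComponentIn hp subset_union_left)
  have hC : IsPreconnected (connectedComponentIn (A ∪ B) p) := isPreconnected_connectedComponentIn
  have hsub := connectedComponentIn_subset (A ∪ B) p
  have hpC := mem_connectedComponentIn (F := A ∪ B) (mem_union_left B hp)
  intro q hq
  by_contra hqA
  obtain ⟨r, -, hrA, hrB⟩ := isPreconnected_closed_iff.1 hC A B hA hB hsub ⟨p, hpC, hp⟩
    ⟨q, hq, (hsub hq).resolve_left hqA⟩
  exact hAB.le_bot ⟨hrA, hrB⟩

theorem connectedComponentIn_union_right {X : Type*} [TopologicalSpace X] {A B : Set X}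
    (hA : IsClosed A) (hB : IsClosed B) (hAB : Disjoint A B) (hBc : IsPreconnected B)
    {p : X} (hp : p ∈ B) : connectedComponentIn (A ∪ B) p = B := by
  rw [union_comm]
  exact connectedComponentIn_union_left hB hA hAB.symm hBc hp

/-- The disjoint union of two closed connected sets has exactly two connected components. -/
theorem card_connectedComponents_union {X : Type*} [TopologicalSpace X] {A B : Set X}
    (hA : IsClosed A) (hB : IsClosed B) (hAB : Disjoint A B) (hAc : IsConnected A)
    (hBc : IsConnected B) : Nat.card (ConnectedComponents ↥(A ∪ B)) = 2 := by
  obtain ⟨a, ha⟩ := hAc.nonempty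
  obtain ⟨b, hb⟩ := hBc.nonempty
  have key : ∀ x y : ↥(A ∪ B), (x : ConnectedComponents ↥(A ∪ B)) = y ↔
      (x : X) ∈ connectedComponentIn (A ∪ B) y := by
    intro x y
    rw [ConnectedComponents.coe_eq_coe', connectedComponentIn_eq_image y.2,
      Subtype.val_injective.mem_set_image]
  rw [Nat.card_eq_two_iff]
  refine ⟨((⟨a, Or.inl ha⟩ : ↥(A ∪ B)) : ConnectedComponents ↥(A ∪ B)),
    ((⟨b, Or.inr hb⟩ : ↥(A ∪ B)) : ConnectedComponents ↥(A ∪ B)), ?_, ?_⟩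
  · rw [Ne, key, connectedComponentIn_union_right hA hB hAB hBc.isPreconnected hb]
    exact fun h => hAB.le_bot ⟨ha, h⟩
  · refine eq_univ_of_forall fun c => ?_
    obtain ⟨x, rfl⟩ := ConnectedComponents.surjective_coe c
    rcases x.2 with hx | hx
    · left
      rw [key, connectedComponentIn_union_left hA hB hAB hAc.isPreconnected ha]
      exact hx
    · right
      rw [mem_singleton_iff, key,
        connectedComponentIn_union_right hA hB hAB hBc.isPreconnected hb]
      exact hx

/-- A positive continuous radial function on the unit sphere embeds the sphere. -/
theorem isClosedEmbedding_radial {E : Type*} [NormedAddCommGroup E] [NormedSpace ℝ E]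
    [ProperSpace E] {ρ : E → ℝ} (hρ : Continuous ρ) (hpos : ∀ x ∈ sphere (0 : E) 1, 0 < ρ x) :
    IsClosedEmbedding (fun n : sphere (0 : E) 1 => ρ n • (n : E)) := by
  refine Continuous.isClosedEmbedding (by fun_prop) ?_
  intro m n hmn
  have hm := hpos m m.2
  have hn := hpos n n.2
  have hnorm := congrArg norm hmn
  simp only [norm_smul, Real.norm_eq_abs, abs_of_pos hm, abs_of_pos hn,
    norm_eq_of_mem_sphere, mul_one] at hnorm
  simp only [hnorm] at hmn
  exact Subtype.ext (smul_right_injective E hn.ne' hmn)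

/-- The quartic form `x²y² + y²z² + z²x²`. -/
def quarticForm (p : EuclideanSpace ℝ (Fin 3)) : ℝ :=
  (p 0)^2*(p 1)^2 + (p 1)^2*(p 2)^2 + (p 2)^2*(p 0)^2

theorem continuous_quarticForm : Continuous quarticForm := by
  unfold quarticForm
  fun_prop

theorem sum_sq_of_norm_eq_one {n : EuclideanSpace ℝ (Fin 3)} (hn : ‖n‖ = 1) :
    (n 0)^2 + (n 1)^2 + (n 2)^2 = 1 := by
  have h := EuclideanSpace.real_norm_sq_eq n
  rw [hn, Fin.sum_univ_three] at h
  linarith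

theorem quarticForm_nonneg (p : EuclideanSpace ℝ (Fin 3)) : 0 ≤ quarticForm p := by
  unfold quarticForm
  positivity

theorem quarticForm_le {n : EuclideanSpace ℝ (Fin 3)} (hn : ‖n‖ = 1) :
    quarticForm n ≤ 1 / 3 := by
  have h := sum_sq_of_norm_eq_one hn
  have h2 : ((n 0)^2 + (n 1)^2 + (n 2)^2) ^ 2 = 1 := by rw [h, one_pow]
  unfold quarticForm
  nlinarith [sq_nonneg ((n 0)^2 - (n 1)^2), sq_nonneg ((n 1)^2 - (n 2)^2),
    sq_nonneg ((n 2)^2 - (n 0)^2)]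

/-- Along a ray through a unit vector `n`, the equation of the quartic is quadratic in the
squared radius. -/
theorem quartic_smul_eq (β k r : ℝ) {n : EuclideanSpace ℝ (Fin 3)} (hn : ‖n‖ = 1) :
    β * (((r • n) 0)^2*((r • n) 1)^2 + ((r • n) 1)^2*((r • n) 2)^2 + ((r • n) 2)^2*((r • n) 0)^2)
        - (((r • n) 0)^2 + ((r • n) 1)^2 + ((r • n) 2)^2 - 1/2)^2 + (1 - k)/4
      = -((1 - β * quarticForm n) * (r ^ 2) ^ 2 - r ^ 2 + k / 4) := by
  have h := sum_sq_of_norm_eq_one hn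
  have h2 : ((r • n) 0)^2 + ((r • n) 1)^2 + ((r • n) 2)^2 = r ^ 2 := by
    simp only [PiLp.smul_apply, smul_eq_mul]
    linear_combination r ^ 2 * h
  rw [h2]
  simp only [PiLp.smul_apply, smul_eq_mul, quarticForm]
  ring

/-- The roots of `a t² - t + k/4`. -/
theorem quadratic_eq_zero_iff_roots {a k t : ℝ} (ha : 0 < a) (hk : a * k ≤ 1) :
    a * t ^ 2 - t + k / 4 = 0 ↔
      t = (1 - √(1 - a * k)) / (2 * a) ∨ t = (1 + √(1 - a * k)) / (2 * a) := by
  have hs := Real.sq_sqrt (sub_nonneg.2 hk)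
  rw [eq_div_iff (by positivity), eq_div_iff (by positivity)]
  constructor
  · intro h
    have : (t * (2 * a) - (1 - √(1 - a * k))) * (t * (2 * a) - (1 + √(1 - a * k))) = 0 := by
      linear_combination 4 * a * h - hs
    rcases mul_eq_zero.1 this with h | h
    · left; linarith
    · right; linarith
  · intro h
    have : 4 * a * (a * t ^ 2 - t + k / 4) = 0 := by
      rcases h with h | h
      · linear_combination (t * (2 * a) - 1 - √(1 - a * k)) * h + hs
      · linear_combination (t * (2 * a) - 1 + √(1 - a * k)) * h + hs
    exact (mul_eq_zero.1 this).resolve_left (by positivity)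

/-- The squared radius of a sheet of the quartic in the direction `n`; the sheet is selected by
the sign `ε`. The maximum makes the function continuous everywhere and is
irrelevant on the unit sphere. -/
noncomputable def sheetRadiusSq (β k ε : ℝ) (n : EuclideanSpace ℝ (Fin 3)) : ℝ :=
  (1 + ε * √(1 - (1 - β * quarticForm n) * k)) /
    (2 * max (1 - β * quarticForm n) (1 - β / 3))

theorem continuous_sheetRadiusSq {β : ℝ} (k ε : ℝ) (hβ : β < 3) :
    Continuous (sheetRadiusSq β k ε) := by
  have := continuous_quarticForm
  unfold sheetRadiusSq
  refine Continuous.div (by fun_prop) (by fun_prop) fun n => ?_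
  have : 0 < max (1 - β * quarticForm n) (1 - β / 3) := lt_max_of_lt_right (by linarith)
  positivity

theorem stmt_15 (β k : ℝ) (hβ0 : 0 < β) (hβ3 : β < 3) (hk0 : 0 < k) (hk1 : k < 1)
    (Q : Set (EuclideanSpace ℝ (Fin 3)))
    (hQ : Q = {p | β * ((p 0)^2*(p 1)^2 + (p 1)^2*(p 2)^2 + (p 2)^2*(p 0)^2)
        - ((p 0)^2 + (p 1)^2 + (p 2)^2 - 1/2)^2 + (1 - k)/4 = 0}) :
    Nat.card (ConnectedComponents ↥Q) = 2 ∧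
    ∀ p ∈ Q, IsCompact (connectedComponentIn Q p) ∧
      Nonempty (↥(connectedComponentIn Q p) ≃ₜ
        ↥(Metric.sphere (0 : EuclideanSpace ℝ (Fin 3)) 1)) := by
  have hbound : ∀ n ∈ sphere (0 : EuclideanSpace ℝ (Fin 3)) 1,
      1 - β / 3 ≤ 1 - β * quarticForm n ∧ 0 < 1 - β * quarticForm n ∧
        0 < (1 - β * quarticForm n) * k ∧ (1 - β * quarticForm n) * k < 1 := by
    intro n hn
    have h0 := mul_nonneg hβ0.le (quarticForm_nonneg n)
    have h1 := mul_le_mul_of_nonneg_left (quarticForm_le (mem_sphere_zero_iff_norm.1 hn)) hβ0.le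
    have h2 : 0 < 1 - β * quarticForm n := by linarith
    exact ⟨by linarith, h2, by positivity, by nlinarith⟩
  have hsq : ∀ ε, ∀ n ∈ sphere (0 : EuclideanSpace ℝ (Fin 3)) 1, sheetRadiusSq β k ε n =
      (1 + ε * √(1 - (1 - β * quarticForm n) * k)) / (2 * (1 - β * quarticForm n)) := by
    intro ε n hn
    rw [sheetRadiusSq, max_eq_left (hbound n hn).1]
  have hpos : ∀ ε, -1 ≤ ε → ∀ n ∈ sphere (0 : EuclideanSpace ℝ (Fin 3)) 1,
      0 < sheetRadiusSq β k ε n := by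
    intro ε hε n hn
    obtain ⟨-, ha, hak, -⟩ := hbound n hn
    rw [hsq ε n hn]
    have h1 : √(1 - (1 - β * quarticForm n) * k) < 1 := by
      rw [Real.sqrt_lt' one_pos]; linarith
    have h0 := Real.sqrt_nonneg (1 - (1 - β * quarticForm n) * k)
    exact div_pos (by nlinarith) (by positivity)
  let φ : ℝ → sphere (0 : EuclideanSpace ℝ (Fin 3)) 1 → EuclideanSpace ℝ (Fin 3) :=
    fun ε n => √(sheetRadiusSq β k ε n) • (n : EuclideanSpace ℝ (Fin 3))
  have hemb : ∀ ε, -1 ≤ ε → IsClosedEmbedding (φ ε) := fun ε hε =>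
    isClosedEmbedding_radial (continuous_sheetRadiusSq k ε hβ3).sqrt
      fun n hn => Real.sqrt_pos.2 (hpos ε hε n hn)
  have hconn : ∀ ε, -1 ≤ ε → IsConnected (range (φ ε)) := by
    intro ε hε
    have hS : IsConnected (sphere (0 : EuclideanSpace ℝ (Fin 3)) 1) :=
      isConnected_sphere (by rw [← Module.finrank_eq_rank]; simp) 0 zero_le_one
    have := isConnected_iff_connectedSpace.1 hS
    exact isConnected_range (hemb ε hε).continuous
  have hdisj : Disjoint (range (φ (-1))) (range (φ 1)) := by
    rw [Set.disjoint_left]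
    rintro _ ⟨m, rfl⟩ ⟨n, hmn⟩
    have hp1 := hpos 1 (by norm_num) n n.2
    have hp2 := hpos (-1) le_rfl m m.2
    have hnorm := congrArg norm hmn
    simp only [φ, norm_smul, Real.norm_eq_abs, abs_of_pos (Real.sqrt_pos.2 hp1),
      abs_of_pos (Real.sqrt_pos.2 hp2), norm_eq_of_mem_sphere, mul_one] at hnorm
    have hnm : (n : EuclideanSpace ℝ (Fin 3)) = m := by
      simp only [φ, hnorm] at hmn
      exact smul_right_injective _ (Real.sqrt_pos.2 hp2).ne' hmn
    rw [Real.sqrt_inj hp1.le hp2.le, hnm, hsq _ _ m.2, hsq _ _ m.2] at hnorm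
    obtain ⟨-, ha, -, hak⟩ := hbound m m.2
    rw [div_left_inj' (by positivity)] at hnorm
    have := Real.sqrt_pos.2 (sub_pos.2 hak)
    linarith
  have hunion : Q = range (φ (-1)) ∪ range (φ 1) := by
    have hmem : ∀ r : ℝ, ∀ n ∈ sphere (0 : EuclideanSpace ℝ (Fin 3)) 1, r • n ∈ Q ↔
        r ^ 2 = sheetRadiusSq β k (-1) n ∨ r ^ 2 = sheetRadiusSq β k 1 n := by
      intro r n hn
      obtain ⟨-, ha, -, hak⟩ := hbound n hn
      rw [hQ, mem_ofPred_eq, quartic_smul_eq β k r (mem_sphere_zero_iff_norm.1 hn), neg_eq_zero,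
        quadratic_eq_zero_iff_roots ha hak.le, hsq _ n hn, hsq _ n hn, one_mul, neg_one_mul,
        ← sub_eq_add_neg]
    ext p
    constructor
    · intro hp
      have hp0 : p ≠ 0 := by
        rintro rfl
        simp only [hQ, mem_ofPred_eq, PiLp.zero_apply] at hp
        linarith
      have hn : ‖p‖⁻¹ • p ∈ sphere (0 : EuclideanSpace ℝ (Fin 3)) 1 := by
        rw [mem_sphere_zero_iff_norm, norm_smul, norm_inv, norm_norm,
          inv_mul_cancel₀ (norm_ne_zero_iff.2 hp0)]
      have hpn : ‖p‖ • ‖p‖⁻¹ • p = p := smul_inv_smul₀ (norm_ne_zero_iff.2 hp0) p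
      rw [← hpn, hmem _ _ hn] at hp
      refine hp.imp (fun h => ⟨⟨_, hn⟩, ?_⟩) (fun h => ⟨⟨_, hn⟩, ?_⟩) <;>
      · simp only [φ]
        rw [← h, Real.sqrt_sq (norm_nonneg p), hpn]
    · rintro (⟨n, rfl⟩ | ⟨n, rfl⟩)
      · exact (hmem _ _ n.2).2 (Or.inl (Real.sq_sqrt (hpos _ le_rfl n n.2).le))
      · exact (hmem _ _ n.2).2 (Or.inr (Real.sq_sqrt (hpos _ (by norm_num) n n.2).le))
  have h1 : (-1 : ℝ) ≤ 1 := by norm_num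
  have hA := (hemb (-1) le_rfl).isClosed_range
  have hB := (hemb 1 h1).isClosed_range
  rw [hunion]
  refine ⟨card_connectedComponents_union hA hB hdisj (hconn _ le_rfl) (hconn _ h1), ?_⟩
  rintro p (hp | hp)
  · rw [connectedComponentIn_union_left hA hB hdisj (hconn _ le_rfl).isPreconnected hp]
    exact ⟨isCompact_range (hemb _ le_rfl).continuous,
      ⟨(hemb _ le_rfl).isEmbedding.toHomeomorph.symm⟩⟩
  · rw [connectedComponentIn_union_right hA hB hdisj (hconn _ h1).isPreconnected hp]
    exact ⟨isCompact_range (hemb _ h1).continuous,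
      ⟨(hemb _ h1).isEmbedding.toHomeomorph.symm⟩⟩
end
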